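/- Let T be a linear isometry of (V, d_{w,(P,π)}) and let i ≤ j in P. Then for any nonzero v_i ∈ V_i and nonzero v_j ∈ V_j, the ideal generated by supp_π(T(v_i)) is contained in the ideal generated by supp_π(T(v_j)). -/

import Mathlib

attribute [local instance] Classical.propDecidable

noncomputable section

variable {ι F : Type*}

section Defs
variable [Fintype ι] [PartialOrder ι] [Field F] [Fintype F] {k : ι → ℕ}

/-- block support -/
def suppB (u : ∀ i, Fin (k i) → F) : Finset ι :=
  Finset.univ.filter fun i => u i ≠ 0

/-- order ideal generated by the block support -/
def idealOf (u : ∀ i, Fin (k i) → F) : Finset ι :=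
  Finset.univ.filter fun i => ∃ j ∈ suppB u, i ≤ j

/-- maximal elements of the ideal generated by the support -/
def maxOf (u : ∀ i, Fin (k i) → F) : Finset ι :=
  (idealOf u).filter fun i => ∀ j ∈ idealOf u, i ≤ j → i = j

/-- maximal weight of a block -/
def Wblk (w : F → ℕ) (u : ∀ i, Fin (k i) → F) (i : ι) : ℕ :=
  Finset.univ.sup fun j => w (u i j)

/-- maximal value of the weight -/
def Mw (w : F → ℕ) : ℕ := Finset.univ.sup w

/-- minimal value of the weight on nonzero elements -/
def mw (w : F → ℕ) : ℕ := sInf (w '' {a | a ≠ 0})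

/-- the weighted poset block weight -/
def omegaW (w : F → ℕ) (u : ∀ i, Fin (k i) → F) : ℕ :=
  (∑ i ∈ maxOf u, Wblk w u i) + (idealOf u \ maxOf u).card * Mw w

/-- principal ideal generated by `i` -/
def pIdeal (i : ι) : Finset ι := Finset.univ.filter fun j => j ≤ i

end Defs

section Block
variable {k : ι → ℕ}

theorem le_Wblk (w : F → ℕ) (u : ∀ i, Fin (k i) → F) (s : ι) (l : Fin (k s)) :
    w (u s l) ≤ Wblk w u s :=
  Finset.le_sup (f := fun j => w (u s j)) (Finset.mem_univ l)

theorem Wblk_congr (w : F → ℕ) {u v : ∀ i, Fin (k i) → F} {s : ι} (h : u s = v s) :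
    Wblk w u s = Wblk w v s := by
  simp [Wblk, h]

theorem le_Mw [Fintype F] (w : F → ℕ) (a : F) : w a ≤ Mw w :=
  Finset.le_sup (f := w) (Finset.mem_univ a)

theorem Wblk_le_Mw [Fintype F] (w : F → ℕ) (u : ∀ i, Fin (k i) → F) (s : ι) :
    Wblk w u s ≤ Mw w :=
  Finset.sup_le fun _ _ => le_Mw w _

theorem Wblk_eq_zero [Field F] {w : F → ℕ} (hw0 : ∀ a : F, w a = 0 ↔ a = 0)
    {u : ∀ i, Fin (k i) → F} {s : ι} : Wblk w u s = 0 ↔ u s = 0 := by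
  constructor
  · intro h
    funext l
    exact (hw0 _).1 (Nat.le_zero.1 (h ▸ le_Wblk w u s l))
  · intro h
    refine Nat.le_zero.1 (Finset.sup_le fun l _ => ?_)
    simp [h, (hw0 0).2 rfl]

theorem exists_eq_Mw [Field F] [Fintype F] (w : F → ℕ) : ∃ c, w c = Mw w := by
  obtain ⟨c, -, hc⟩ := Finset.exists_mem_eq_sup Finset.univ Finset.univ_nonempty w
  exact ⟨c, hc.symm⟩

theorem exists_smul_Wblk_eq_Mw [Field F] [Fintype F] (w : F → ℕ)
    {u : ∀ i, Fin (k i) → F} {s : ι} (h : u s ≠ 0) : ∃ a : F, Wblk w (a • u) s = Mw w := by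
  obtain ⟨l, hl⟩ := Function.ne_iff.1 h
  obtain ⟨c, hc⟩ := exists_eq_Mw w
  refine ⟨c / u s l, le_antisymm (Wblk_le_Mw _ _ _) ?_⟩
  have := le_Wblk w ((c / u s l) • u) s l
  have e : ((c / u s l) • u) s l = c := by
    simp only [Pi.smul_apply, smul_eq_mul]
    exact div_mul_cancel₀ _ hl
  rwa [e, hc] at this

theorem Wblk_smul_single_single [Field F] {w : F → ℕ} (hw0 : ∀ a : F, w a = 0 ↔ a = 0)
    (i : ι) (l : Fin (k i)) (a : F) :
    Wblk w (a • (Pi.single i (Pi.single l 1) : ∀ i, Fin (k i) → F)) i = w a := by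
  refine le_antisymm (Finset.sup_le fun m _ => ?_) ?_
  · by_cases h : m = l
    · subst h
      simp
    · simp [h, (hw0 0).2 rfl]
  · simpa using le_Wblk w (a • (Pi.single i (Pi.single l 1) : ∀ i, Fin (k i) → F)) i l

theorem sum_weight_le_sum_Wblk_smul [Field F] [Fintype F] (w : F → ℕ)
    {u : ∀ i, Fin (k i) → F} {s : ι} (h : u s ≠ 0) : ∑ a, w a ≤ ∑ a : F, Wblk w (a • u) s := by
  obtain ⟨l, hl⟩ := Function.ne_iff.1 h
  rw [← Equiv.sum_comp (Equiv.mulRight₀ (u s l) hl) w]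
  exact Finset.sum_le_sum fun a _ => by simpa using le_Wblk w (a • u) s l

/-- The vectors whose block support lies in `D`. -/
def supportedOn (k : ι → ℕ) (F : Type*) [Field F] (D : Finset ι) :
    Submodule F (∀ i, Fin (k i) → F) where
  carrier := {u | ∀ s ∉ D, u s = 0}
  add_mem' := fun ha hb s hs => by simp [ha s hs, hb s hs]
  zero_mem' := fun _ _ => rfl
  smul_mem' := fun c a ha s hs => by simp [ha s hs]

theorem single_mem_supportedOn [Field F] {D : Finset ι} {i : ι} (hi : i ∈ D)
    (x : Fin (k i) → F) :
    (Pi.single i x : ∀ i, Fin (k i) → F) ∈ supportedOn k F D := fun s hs => by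
  have : s ≠ i := fun h => hs (h ▸ hi)
  simp [this]

theorem supportedOn_mono [Field F] {D E : Finset ι} (h : D ⊆ E) :
    supportedOn k F D ≤ supportedOn k F E :=
  fun _ hu s hs => hu s fun hsD => hs (h hsD)

end Block

section BlockCost
variable [Fintype ι] [PartialOrder ι] [Field F] [Fintype F] {k : ι → ℕ}

/-- The contribution of the position `s` to the weight of `u`. -/
def blockCost (w : F → ℕ) (u : ∀ i, Fin (k i) → F) (s : ι) : ℕ :=
  if ∃ t, s < t ∧ u t ≠ 0 then Mw w else Wblk w u s

/-- The part of the weight of `u` that is carried by positions outside `D`. -/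
def relWeight (w : F → ℕ) (D : Finset ι) (u : ∀ i, Fin (k i) → F) : ℕ :=
  ∑ s ∈ Dᶜ, blockCost w u s

theorem Mw_pos {w : F → ℕ} (hw0 : ∀ a : F, w a = 0 ↔ a = 0) : 0 < Mw w :=
  lt_of_lt_of_le (Nat.pos_of_ne_zero (mt (hw0 1).1 one_ne_zero)) (le_Mw w 1)

theorem Wblk_le_blockCost (w : F → ℕ) (u : ∀ i, Fin (k i) → F) (s : ι) :
    Wblk w u s ≤ blockCost w u s := by
  unfold blockCost
  split_ifs
  · exact Wblk_le_Mw w u s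
  · exact le_rfl

theorem blockCost_le_Mw (w : F → ℕ) (u : ∀ i, Fin (k i) → F) (s : ι) :
    blockCost w u s ≤ Mw w := by
  unfold blockCost
  split_ifs
  · exact le_rfl
  · exact Wblk_le_Mw w u s

theorem blockCost_pos {w : F → ℕ} (hw0 : ∀ a : F, w a = 0 ↔ a = 0)
    {u : ∀ i, Fin (k i) → F} {s : ι} (h : u s ≠ 0) : 0 < blockCost w u s :=
  lt_of_lt_of_le (Nat.pos_of_ne_zero (mt (Wblk_eq_zero hw0).1 h)) (Wblk_le_blockCost w u s)

theorem blockCost_of_lt (w : F → ℕ) {u : ∀ i, Fin (k i) → F} {s t : ι} (hst : s < t)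
    (h : u t ≠ 0) : blockCost w u s = Mw w :=
  if_pos ⟨t, hst, h⟩

theorem blockCost_of_forall (w : F → ℕ) {u : ∀ i, Fin (k i) → F} {s : ι}
    (h : ∀ t, s < t → u t = 0) : blockCost w u s = Wblk w u s :=
  if_neg fun ⟨t, ht, hu⟩ => hu (h t ht)

theorem omegaW_eq_sum_blockCost {w : F → ℕ} (hw0 : ∀ a : F, w a = 0 ↔ a = 0)
    (u : ∀ i, Fin (k i) → F) : omegaW w u = ∑ s, blockCost w u s := by
  have mem_ideal : ∀ s, s ∈ idealOf u ↔ ∃ t, u t ≠ 0 ∧ s ≤ t := fun s => by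
    simp [idealOf, suppB]
  have mem_max : ∀ s, s ∈ maxOf u ↔ u s ≠ 0 ∧ ∀ t, s < t → u t = 0 := fun s => by
    simp only [maxOf, Finset.mem_filter, mem_ideal]
    constructor
    · rintro ⟨⟨t, ht, hst⟩, h⟩
      obtain rfl := h t ⟨t, ht, le_rfl⟩ hst
      refine ⟨ht, fun t' ht' => ?_⟩
      by_contra hne
      exact ht'.ne (h t' ⟨t', hne, le_rfl⟩ ht'.le)
    · rintro ⟨hs, h⟩
      refine ⟨⟨s, hs, le_rfl⟩, fun t ⟨r, hr, htr⟩ hst => ?_⟩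
      by_contra hne
      exact hr (h r (lt_of_lt_of_le (lt_of_le_of_ne hst hne) htr))
  have e1 : ∑ i ∈ maxOf u, Wblk w u i = ∑ i, if i ∈ maxOf u then Wblk w u i else 0 := by
    simp
  have e2 : (idealOf u \ maxOf u).card * Mw w
      = ∑ i, if i ∈ idealOf u \ maxOf u then Mw w else 0 := by
    rw [Finset.sum_ite_mem, Finset.univ_inter, Finset.sum_const, smul_eq_mul]
  rw [omegaW, e1, e2, ← Finset.sum_add_distrib]
  refine Finset.sum_congr rfl fun s _ => ?_
  by_cases hs : ∃ t, s < t ∧ u t ≠ 0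
  · obtain ⟨t, hst, ht⟩ := hs
    have h1 : s ∉ maxOf u := fun h => ht (((mem_max s).1 h).2 t hst)
    have h2 : s ∈ idealOf u := (mem_ideal s).2 ⟨t, ht, hst.le⟩
    simp [h1, h2, blockCost_of_lt w hst ht]
  · push Not at hs
    rw [blockCost_of_forall w hs]
    by_cases h0 : u s = 0
    · have h1 : s ∉ maxOf u := fun h => ((mem_max s).1 h).1 h0
      have h2 : s ∉ idealOf u := fun h => by
        obtain ⟨t, ht, hst⟩ := (mem_ideal s).1 h
        rcases hst.eq_or_lt with rfl | hlt
        · exact ht h0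
        · exact ht (hs t hlt)
      simp [h1, h2, (Wblk_eq_zero hw0).2 h0]
    · have h1 : s ∈ maxOf u := (mem_max s).2 ⟨h0, hs⟩
      simp [h1]

theorem omegaW_eq_relWeight_add {w : F → ℕ} (hw0 : ∀ a : F, w a = 0 ↔ a = 0)
    (D : Finset ι) (u : ∀ i, Fin (k i) → F) :
    omegaW w u = relWeight w D u + ∑ s ∈ D, blockCost w u s := by
  rw [omegaW_eq_sum_blockCost hw0, relWeight, Finset.sum_compl_add_sum]

theorem blockCost_add_le_relWeight (w : F → ℕ) {D : Finset ι} {s t : ι} (hst : s ≠ t)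
    (hs : s ∉ D) (ht : t ∉ D) (u : ∀ i, Fin (k i) → F) :
    blockCost w u s + blockCost w u t ≤ relWeight w D u := by
  rw [← Finset.sum_pair hst]
  refine Finset.sum_le_sum_of_subset fun r hr => ?_
  rcases Finset.mem_insert.1 hr with rfl | hr
  · exact Finset.mem_compl.2 hs
  · exact Finset.mem_compl.2 (Finset.mem_singleton.1 hr ▸ ht)

theorem relWeight_add (w : F → ℕ) {D : Finset ι} (hD : IsLowerSet (D : Set ι))
    (u : ∀ i, Fin (k i) → F) {z : ∀ i, Fin (k i) → F} (hz : z ∈ supportedOn k F D) :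
    relWeight w D (u + z) = relWeight w D u := by
  refine Finset.sum_congr rfl fun s hs => ?_
  have hs : s ∉ D := Finset.mem_compl.1 hs
  have key : ∀ t, s ≤ t → (u + z) t = u t := fun t hst => by
    simp [hz t fun ht => hs (hD hst ht)]
  have hiff : (∃ t, s < t ∧ (u + z) t ≠ 0) ↔ ∃ t, s < t ∧ u t ≠ 0 :=
    exists_congr fun t => and_congr_right fun hst => by rw [key t hst.le]
  simp only [blockCost, hiff, Wblk_congr w (key s le_rfl)]

/-- A vector supported on `D ∪ {t}` has relative weight equal to that of its block at `t`. -/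
theorem relWeight_eq_Wblk {w : F → ℕ} (hw0 : ∀ a : F, w a = 0 ↔ a = 0) {D : Finset ι}
    (hD : IsLowerSet (D : Set ι)) {t : ι} (ht : t ∉ D) (htD : ∀ s < t, s ∈ D)
    {u : ∀ i, Fin (k i) → F} (hu : u ∈ supportedOn k F (insert t D)) :
    relWeight w D u = Wblk w u t := by
  have hzero : ∀ s, s ∉ D → ∀ r, s < r → u r = 0 := fun s hs r hsr => by
    refine hu r fun hr => ?_
    rcases Finset.mem_insert.1 hr with rfl | hr
    · exact hs (htD s hsr)
    · exact hs (hD hsr.le hr)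
  rw [relWeight, Finset.sum_eq_single t, blockCost_of_forall w (hzero t ht)]
  · intro s hs hst
    have hs := Finset.mem_compl.1 hs
    rw [blockCost_of_forall w (hzero s hs), Wblk_eq_zero hw0]
    exact hu s (by simp [hs, hst])
  · intro h
    exact absurd (Finset.mem_compl.2 ht) h

/-- The weight of a vector supported on `D ∪ {t}` with a nonzero block at `t`. -/
theorem omegaW_eq_of_mem_insert {w : F → ℕ} (hw0 : ∀ a : F, w a = 0 ↔ a = 0) {D : Finset ι}
    (hD : IsLowerSet (D : Set ι)) {t : ι} (ht : t ∉ D)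
    {u : ∀ i, Fin (k i) → F} (hu : u ∈ supportedOn k F (insert t D)) (hut : u t ≠ 0) :
    omegaW w u = Wblk w u t + ((pIdeal t).erase t).card * Mw w
      + ∑ s ∈ (pIdeal t)ᶜ, blockCost w u s := by
  have hmem : t ∈ pIdeal t := by simp [pIdeal]
  rw [omegaW_eq_sum_blockCost hw0, ← Finset.sum_add_sum_compl (pIdeal t),
    ← Finset.add_sum_erase _ _ hmem]
  congr 2
  · refine blockCost_of_forall w fun r hr => hu r fun hmr => ?_
    rcases Finset.mem_insert.1 hmr with rfl | hmr
    · exact lt_irrefl _ hr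
    · exact ht (hD hr.le hmr)
  · rw [← smul_eq_mul, ← Finset.sum_const]
    refine Finset.sum_congr rfl fun s hs => ?_
    simp only [pIdeal, Finset.mem_erase, Finset.mem_filter, Finset.mem_univ, true_and] at hs
    exact blockCost_of_lt w (lt_of_le_of_ne hs.2 hs.1) hut

theorem sum_blockCost_compl_pIdeal {w : F → ℕ} (hw0 : ∀ a : F, w a = 0 ↔ a = 0) {t : ι}
    {u : ∀ i, Fin (k i) → F} :
    ∑ s ∈ (pIdeal t)ᶜ, blockCost w u s = 0 ↔ u ∈ supportedOn k F (pIdeal t) := by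
  rw [Finset.sum_eq_zero_iff]
  constructor
  · intro h s hs
    by_contra hne
    exact (blockCost_pos hw0 hne).ne' (h s (Finset.mem_compl.2 hs))
  · intro h s hs
    have hs : ¬ s ≤ t := by simpa [pIdeal] using hs
    have key : ∀ r, s ≤ r → u r = 0 := fun r hr =>
      h r (by simpa [pIdeal] using fun hrt => hs (hr.trans hrt))
    rw [blockCost_of_forall w fun r hr => key r hr.le, Wblk_eq_zero hw0]
    exact key s le_rfl

end BlockCost

section Isometry
variable [Fintype ι] [PartialOrder ι] [Field F] [Fintype F] {k : ι → ℕ} {w : F → ℕ}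
  {T : (∀ i, Fin (k i) → F) ≃ₗ[F] (∀ i, Fin (k i) → F)} {D : Finset ι}

theorem relWeight_le_relWeight_map (hk : ∀ i, 0 < k i) (hw0 : ∀ a : F, w a = 0 ↔ a = 0)
    (hT : ∀ u, omegaW w (T u) = omegaW w u) (hD : IsLowerSet (D : Set ι))
    (hTD : ∀ u ∈ supportedOn k F D, T u ∈ supportedOn k F D) (u : ∀ i, Fin (k i) → F) :
    relWeight w D u ≤ relWeight w D (T u) := by
  obtain ⟨c, hc⟩ := exists_eq_Mw w
  let z : ∀ i, Fin (k i) → F := fun s => if s ∈ D then (fun _ => c) - u s else 0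
  have hz : z ∈ supportedOn k F D := fun s hs => if_neg hs
  have h1 := omegaW_eq_relWeight_add hw0 D (u + z)
  have h2 := omegaW_eq_relWeight_add hw0 D (T (u + z))
  rw [relWeight_add w hD u hz] at h1
  rw [hT, map_add, relWeight_add w hD (T u) (hTD z hz)] at h2
  have h3 : ∑ s ∈ D, blockCost w (T u + T z) s ≤ ∑ s ∈ D, blockCost w (u + z) s := by
    refine Finset.sum_le_sum fun s hs => (blockCost_le_Mw w _ s).trans ?_
    refine le_trans ?_ (Wblk_le_blockCost w _ s)
    have := le_Wblk w (u + z) s ⟨0, hk s⟩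
    have e : (u + z) s ⟨0, hk s⟩ = c := by simp [z, hs]
    rwa [e, hc] at this
  omega

theorem relWeight_map (hk : ∀ i, 0 < k i) (hw0 : ∀ a : F, w a = 0 ↔ a = 0)
    (hT : ∀ u, omegaW w (T u) = omegaW w u) (hD : IsLowerSet (D : Set ι))
    (hTD : ∀ u, T u ∈ supportedOn k F D ↔ u ∈ supportedOn k F D) (u : ∀ i, Fin (k i) → F) :
    relWeight w D (T u) = relWeight w D u := by
  refine le_antisymm ?_ (relWeight_le_relWeight_map hk hw0 hT hD (fun v => (hTD v).2) u)
  have := relWeight_le_relWeight_map (T := T.symm) hk hw0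
    (fun v => by rw [← hT, T.apply_symm_apply]) hD
    (fun v hv => (hTD _).1 (by rwa [T.apply_symm_apply])) (T u)
  rwa [T.symm_apply_apply] at this

/-- Blocks that are minimal outside `D` are sent to blocks that are minimal outside `D`. -/
theorem forall_lt_mem_of_map_ne_zero (hk : ∀ i, 0 < k i) (hw0 : ∀ a : F, w a = 0 ↔ a = 0)
    (hT : ∀ u, omegaW w (T u) = omegaW w u) (hD : IsLowerSet (D : Set ι))
    (hTD : ∀ u, T u ∈ supportedOn k F D ↔ u ∈ supportedOn k F D)
    {i : ι} (hiD : ∀ s < i, s ∈ D) {u : ∀ i, Fin (k i) → F}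
    (hu : u ∈ supportedOn k F (insert i D)) {t : ι} (ht : T u t ≠ 0) : ∀ s < t, s ∈ D := by
  by_cases hi : i ∈ D
  · rw [Finset.insert_eq_of_mem hi] at hu
    have htD : t ∈ D := by
      by_contra h
      exact ht ((hTD u).2 hu t h)
    exact fun s hs => hD hs.le htD
  · intro s hst
    by_contra hs
    have htD : t ∉ D := fun h => hs (hD hst.le h)
    have h1 := relWeight_map hk hw0 hT hD hTD u
    rw [relWeight_eq_Wblk hw0 hD hi hiD hu] at h1
    have h2 : blockCost w (T u) s + blockCost w (T u) t ≤ relWeight w D (T u) :=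
      blockCost_add_le_relWeight w hst.ne hs htD _
    have h3 := blockCost_of_lt w hst ht
    have h4 := blockCost_pos hw0 ht
    have h5 := Wblk_le_Mw w u i
    omega

/-- `D` together with the minimal elements of its complement. -/
def addMinimal (D : Finset ι) : Finset ι := Finset.univ.filter fun t => ∀ s < t, s ∈ D

theorem mem_addMinimal {t : ι} : t ∈ addMinimal D ↔ ∀ s < t, s ∈ D := by
  simp [addMinimal]

theorem subset_addMinimal (hD : IsLowerSet (D : Set ι)) : D ⊆ addMinimal D :=
  fun _ ht => mem_addMinimal.2 fun _ hs => hD hs.le ht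

theorem isLowerSet_addMinimal : IsLowerSet (addMinimal D : Set ι) := fun _ _ hba ha =>
  mem_addMinimal.2 fun s hs => mem_addMinimal.1 ha s (hs.trans_le hba)

theorem map_mem_supportedOn_addMinimal (hk : ∀ i, 0 < k i) (hw0 : ∀ a : F, w a = 0 ↔ a = 0)
    (hT : ∀ u, omegaW w (T u) = omegaW w u) (hD : IsLowerSet (D : Set ι))
    (hTD : ∀ u, T u ∈ supportedOn k F D ↔ u ∈ supportedOn k F D)
    {u : ∀ i, Fin (k i) → F} (hu : u ∈ supportedOn k F (addMinimal D)) :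
    T u ∈ supportedOn k F (addMinimal D) := by
  rw [← Finset.univ_sum_single u, map_sum]
  refine Submodule.sum_mem _ fun i _ => ?_
  by_cases hi : i ∈ addMinimal D
  · intro t ht
    by_contra hne
    exact ht (mem_addMinimal.2 (forall_lt_mem_of_map_ne_zero hk hw0 hT hD hTD
      (mem_addMinimal.1 hi) (single_mem_supportedOn (Finset.mem_insert_self i D) _) hne))
  · simp [hu i hi]

theorem map_mem_supportedOn_addMinimal_iff (hk : ∀ i, 0 < k i)
    (hw0 : ∀ a : F, w a = 0 ↔ a = 0)
    (hT : ∀ u, omegaW w (T u) = omegaW w u) (hD : IsLowerSet (D : Set ι))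
    (hTD : ∀ u, T u ∈ supportedOn k F D ↔ u ∈ supportedOn k F D)
    (u : ∀ i, Fin (k i) → F) :
    T u ∈ supportedOn k F (addMinimal D) ↔ u ∈ supportedOn k F (addMinimal D) := by
  refine ⟨fun h => ?_, map_mem_supportedOn_addMinimal hk hw0 hT hD hTD⟩
  have := map_mem_supportedOn_addMinimal (T := T.symm) hk hw0
    (fun v => by rw [← hT, T.apply_symm_apply]) hD
    (fun v => by rw [← hTD, T.apply_symm_apply]) h
  rwa [T.symm_apply_apply] at this

/-- Every `j` is minimal outside some lower set whose vectors are preserved by `T`. -/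
theorem exists_invariant_lowerSet (hk : ∀ i, 0 < k i) (hw0 : ∀ a : F, w a = 0 ↔ a = 0)
    (hT : ∀ u, omegaW w (T u) = omegaW w u) (j : ι) :
    ∃ D : Finset ι, IsLowerSet (D : Set ι) ∧
      (∀ u, T u ∈ supportedOn k F D ↔ u ∈ supportedOn k F D) ∧ j ∉ D ∧ ∀ s < j, s ∈ D := by
  let good : Set (Finset ι) := {D | IsLowerSet (D : Set ι) ∧
    (∀ u, T u ∈ supportedOn k F D ↔ u ∈ supportedOn k F D) ∧ j ∉ D}
  have hbot : ∀ u : ∀ i, Fin (k i) → F, u ∈ supportedOn k F (∅ : Finset ι) ↔ u = 0 := fun u =>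
    ⟨fun h => funext fun s => h s (Finset.notMem_empty s), fun h => h ▸ Submodule.zero_mem _⟩
  have hne : good.Nonempty := by
    refine ⟨∅, by simp [isLowerSet_empty], fun u => ?_, Finset.notMem_empty j⟩
    rw [hbot, hbot, LinearEquiv.map_eq_zero_iff]
  obtain ⟨D, hDmax⟩ := (Set.toFinite good).exists_maximal hne
  obtain ⟨hD, hTD, hj⟩ := hDmax.prop
  refine ⟨D, hD, hTD, hj, ?_⟩
  by_contra hcon
  have hle : addMinimal D ≤ D := hDmax.le_of_ge
    ⟨isLowerSet_addMinimal, map_mem_supportedOn_addMinimal_iff hk hw0 hT hD hTD,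
      fun h => hcon (mem_addMinimal.1 h)⟩ (subset_addMinimal hD)
  obtain ⟨s, hs⟩ := (Set.toFinite {s | s ∉ D}).exists_minimal ⟨j, hj⟩
  refine hs.prop (hle (mem_addMinimal.2 fun r hr => ?_))
  by_contra hrD
  exact hr.not_ge (hs.le_of_le hrD hr.le)

/-- A unit vector of a block minimal outside `D` is sent, modulo `D`, into a single block. -/
theorem exists_map_single_single_mem (hk : ∀ i, 0 < k i) (hw0 : ∀ a : F, w a = 0 ↔ a = 0)
    (hT : ∀ u, omegaW w (T u) = omegaW w u) (hD : IsLowerSet (D : Set ι))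
    (hTD : ∀ u, T u ∈ supportedOn k F D ↔ u ∈ supportedOn k F D)
    {i : ι} (hi : i ∉ D) (hiD : ∀ s < i, s ∈ D) (l : Fin (k i)) :
    ∃ t ∉ D, T (Pi.single i (Pi.single l 1)) t ≠ 0 ∧
      T (Pi.single i (Pi.single l 1)) ∈ supportedOn k F (insert t D) := by
  set e : ∀ i, Fin (k i) → F := Pi.single i (Pi.single l 1) with he
  have heD : e ∉ supportedOn k F D := fun h => by
    have := congrFun (h i hi) l
    simp [he] at this
  have : ∃ t ∉ D, T e t ≠ 0 := by
    by_contra! h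
    exact heD ((hTD e).1 h)
  obtain ⟨t, ht, hte⟩ := this
  refine ⟨t, ht, hte, fun s hs => ?_⟩
  by_contra hse
  simp only [Finset.mem_insert, not_or] at hs
  have hpair : ∀ a : F, Wblk w (a • T e) s + Wblk w (a • T e) t ≤ w a := fun a => by
    have hmem : a • e ∈ supportedOn k F (insert i D) :=
      Submodule.smul_mem _ _ (single_mem_supportedOn (Finset.mem_insert_self i D) _)
    have h1 := relWeight_map hk hw0 hT hD hTD (a • e)
    rw [relWeight_eq_Wblk hw0 hD hi hiD hmem, Wblk_smul_single_single hw0, map_smul] at h1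
    rw [← h1]
    exact (add_le_add (Wblk_le_blockCost w _ s) (Wblk_le_blockCost w _ t)).trans
      (blockCost_add_le_relWeight w hs.1 hs.2 ht _)
  have h2 := Finset.sum_le_sum fun a (_ : a ∈ (Finset.univ : Finset F)) => hpair a
  rw [Finset.sum_add_distrib] at h2
  have h3 := sum_weight_le_sum_Wblk_smul w hse
  have h4 := sum_weight_le_sum_Wblk_smul w hte
  have h5 : 0 < ∑ a, w a := lt_of_lt_of_le (Nat.pos_of_ne_zero (mt (hw0 1).1 one_ne_zero))
    (Finset.single_le_sum (fun _ _ => Nat.zero_le _) (Finset.mem_univ (1 : F)))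
  omega

/-- A block minimal outside `D` is sent, modulo `D`, into a single block. -/
theorem exists_map_single_mem (hk : ∀ i, 0 < k i) (hw0 : ∀ a : F, w a = 0 ↔ a = 0)
    (hT : ∀ u, omegaW w (T u) = omegaW w u) (hD : IsLowerSet (D : Set ι))
    (hTD : ∀ u, T u ∈ supportedOn k F D ↔ u ∈ supportedOn k F D)
    {i : ι} (hi : i ∉ D) (hiD : ∀ s < i, s ∈ D) :
    ∃ t ∉ D, (∀ s < t, s ∈ D) ∧
      ∀ x, T (Pi.single i x) ∈ supportedOn k F (insert t D) := by
  choose t ht hne hmem using exists_map_single_single_mem hk hw0 hT hD hTD hi hiD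
  have hunit : ∀ x : Fin (k i) → F,
      (Pi.single i x : ∀ i, Fin (k i) → F) ∈ supportedOn k F (insert i D) :=
    single_mem_supportedOn (Finset.mem_insert_self i D)
  have hsame : ∀ l m, t l = t m := fun l m => by
    by_contra hlm
    obtain ⟨a, ha⟩ := exists_smul_Wblk_eq_Mw w (hne l)
    obtain ⟨b, hb⟩ := exists_smul_Wblk_eq_Mw w (hne m)
    set x : ∀ i, Fin (k i) → F := Pi.single i (Pi.single l 1)
    set y : ∀ i, Fin (k i) → F := Pi.single i (Pi.single m 1)
    have h1 := relWeight_map hk hw0 hT hD hTD (a • x + b • y)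
    rw [relWeight_eq_Wblk hw0 hD hi hiD (Submodule.add_mem _
      (Submodule.smul_mem _ _ (hunit _)) (Submodule.smul_mem _ _ (hunit _)))] at h1
    rw [map_add, map_smul, map_smul] at h1
    have hl : Wblk w (a • T x + b • T y) (t l) = Mw w := by
      rw [← ha]
      refine Wblk_congr w ?_
      have : T y (t l) = 0 := hmem m _ (by simp [ht l, hlm])
      simp [this]
    have hm : Wblk w (a • T x + b • T y) (t m) = Mw w := by
      rw [← hb]
      refine Wblk_congr w ?_
      have : T x (t m) = 0 := hmem l _ (by simp [ht m, Ne.symm hlm])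
      simp [this]
    have h2 : blockCost w (a • T x + b • T y) (t l) + blockCost w (a • T x + b • T y) (t m)
        ≤ relWeight w D (a • T x + b • T y) :=
      blockCost_add_le_relWeight w hlm (ht l) (ht m) _
    have h3 := Wblk_le_blockCost w (a • T x + b • T y) (t l)
    have h4 := Wblk_le_blockCost w (a • T x + b • T y) (t m)
    have h5 := h1.trans_le (Wblk_le_Mw w _ i)
    have h6 := Mw_pos hw0
    omega
  refine ⟨t ⟨0, hk i⟩, ht _,
    forall_lt_mem_of_map_ne_zero hk hw0 hT hD hTD hiD (hunit _) (hne _), fun x => ?_⟩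
  have hx : (Pi.single i x : ∀ i, Fin (k i) → F)
      = ∑ l, x l • Pi.single i (Pi.single l 1) := by
    conv_lhs => rw [← Finset.univ_sum_single x, ← LinearMap.coe_single F, map_sum]
    refine Finset.sum_congr rfl fun l _ => ?_
    rw [LinearMap.coe_single, ← Pi.single_smul, ← Pi.single_smul, smul_eq_mul, mul_one]
  rw [hx, map_sum]
  refine Submodule.sum_mem _ fun l _ => ?_
  rw [map_smul, hsame ⟨0, hk i⟩ l]
  exact Submodule.smul_mem _ _ (hmem l)

/-- A linear isometry sends the nonzero vectors of a block to vectors generating one and the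
same principal ideal, and the vectors of all smaller blocks into that ideal. -/
theorem exists_map_mem_supportedOn_pIdeal (hk : ∀ i, 0 < k i)
    (hw0 : ∀ a : F, w a = 0 ↔ a = 0) (hT : ∀ u, omegaW w (T u) = omegaW w u) (j : ι) :
    ∃ t, (∀ x ≠ 0, T (Pi.single j x) t ≠ 0) ∧
      ∀ u ∈ supportedOn k F (pIdeal j), T u ∈ supportedOn k F (pIdeal t) := by
  obtain ⟨D, hD, hTD, hj, hjD⟩ := exists_invariant_lowerSet hk hw0 hT j
  obtain ⟨t, ht, htD, hmap⟩ := exists_map_single_mem hk hw0 hT hD hTD hj hjD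
  have hins : ∀ {t : ι}, (∀ s < t, s ∈ D) → pIdeal t ⊆ insert t D := fun h s hs => by
    simp only [pIdeal, Finset.mem_filter, Finset.mem_univ, true_and] at hs
    rcases hs.eq_or_lt with rfl | hlt
    · exact Finset.mem_insert_self _ _
    · exact Finset.mem_insert_of_mem (h s hlt)
  have hmapI : ∀ u ∈ supportedOn k F (insert j D), T u ∈ supportedOn k F (insert t D) := by
    intro u hu
    have hz : u - Pi.single j (u j) ∈ supportedOn k F D := fun s hs => by
      by_cases h : s = j
      · subst h
        simp
      · simp [h, hu s (by simp [h, hs])]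
    rw [← sub_add_cancel u (Pi.single j (u j)), map_add]
    exact Submodule.add_mem _ (supportedOn_mono (Finset.subset_insert t D) ((hTD _).2 hz))
      (hmap _)
  have hW : ∀ u ∈ supportedOn k F (insert j D), Wblk w (T u) t = Wblk w u j := fun u hu => by
    rw [← relWeight_eq_Wblk hw0 hD ht htD (hmapI u hu), relWeight_map hk hw0 hT hD hTD,
      relWeight_eq_Wblk hw0 hD hj hjD hu]
  have hnz : ∀ u ∈ supportedOn k F (insert j D), u j ≠ 0 → T u t ≠ 0 := fun u hu hne h =>
    hne ((Wblk_eq_zero hw0).1 ((hW u hu).symm.trans ((Wblk_eq_zero hw0).2 h)))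
  have hsingle : ∀ x : Fin (k j) → F,
      (Pi.single j x : ∀ i, Fin (k i) → F) ∈ supportedOn k F (insert j D) :=
    single_mem_supportedOn (Finset.mem_insert_self j D)
  let v : ∀ i, Fin (k i) → F := Pi.single j (fun _ => 1)
  have hvj : v j ≠ 0 := fun h => by
    have := congrFun h ⟨0, hk j⟩
    simp [v] at this
  have hcard : ((pIdeal j).erase j).card ≤ ((pIdeal t).erase t).card := by
    let z : ∀ i, Fin (k i) → F := T v - Pi.single t (T v t)
    have hz : z ∈ supportedOn k F D := fun s hs => by
      by_cases h : s = t
      · subst h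
        simp [z]
      · have : T v s = 0 := hmap _ s (by simp [h, hs])
        simp [z, h, this]
    have hz' : T.symm z ∈ supportedOn k F D := (hTD _).1 (by rwa [T.apply_symm_apply])
    have hu : v - T.symm z ∈ supportedOn k F (insert j D) :=
      Submodule.sub_mem _ (hsingle _) (supportedOn_mono (Finset.subset_insert j D) hz')
    have huj : (v - T.symm z) j ≠ 0 := by simpa [hz' j hj] using hvj
    have hTu : T (v - T.symm z) = Pi.single t (T v t) := by simp [z]
    have h1 := omegaW_eq_of_mem_insert hw0 hD hj hu huj
    have h2 := omegaW_eq_of_mem_insert hw0 hD ht (hmapI _ hu) (hnz _ hu huj)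
    have h3 : ∑ s ∈ (pIdeal t)ᶜ, blockCost w (T (v - T.symm z)) s = 0 := by
      rw [sum_blockCost_compl_pIdeal hw0, hTu]
      exact single_mem_supportedOn (by simp [pIdeal]) _
    rw [hT, hW _ hu, h3] at h2
    exact Nat.le_of_mul_le_mul_right (by omega) (Mw_pos hw0)
  have hmain : ∀ u ∈ supportedOn k F (pIdeal j), u j ≠ 0 →
      T u ∈ supportedOn k F (pIdeal t) := fun u hu huj => by
    have hu' := supportedOn_mono (hins hjD) hu
    have h1 := omegaW_eq_of_mem_insert hw0 hD hj hu' huj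
    have h2 := omegaW_eq_of_mem_insert hw0 hD ht (hmapI _ hu') (hnz _ hu' huj)
    rw [(sum_blockCost_compl_pIdeal hw0).2 hu] at h1
    rw [hT, hW _ hu'] at h2
    have h3 := Nat.mul_le_mul_right (Mw w) hcard
    rw [← sum_blockCost_compl_pIdeal hw0]
    omega
  refine ⟨t, fun x hx => hnz _ (hsingle x) (by simpa using hx), fun u hu => ?_⟩
  by_cases huj : u j = 0
  · have hv : v ∈ supportedOn k F (pIdeal j) := single_mem_supportedOn (by simp [pIdeal]) _
    rw [← add_sub_cancel_right u v, map_sub]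
    exact Submodule.sub_mem _
      (hmain _ (Submodule.add_mem _ hu hv) (by simpa [huj] using hvj)) (hmain _ hv hvj)
  · exact hmain u hu huj

end Isometry

/-- If `i ≤ j` then for nonzero `v_i ∈ V_i`, `v_j ∈ V_j`,
`I_{T v_i}^P ⊆ I_{T v_j}^P`. -/
theorem stmt9 [Fintype ι] [PartialOrder ι] [Field F] [Fintype F] {k : ι → ℕ}
    (hk : ∀ i, 0 < k i)
    (w : F → ℕ)
    (hw0 : ∀ a : F, w a = 0 ↔ a = 0)
    (hwneg : ∀ a : F, w (-a) = w a)
    (hwadd : ∀ a b : F, w (a + b) ≤ w a + w b)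
    (T : (∀ i, Fin (k i) → F) →ₗ[F] (∀ i, Fin (k i) → F))
    (hT : ∀ u : ∀ i, Fin (k i) → F, omegaW w (T u) = omegaW w u)
    (i j : ι) (hij : i ≤ j)
    (vi vj : ∀ i, Fin (k i) → F)
    (hvi : suppB vi ⊆ {i}) (hvine : vi ≠ 0)
    (hvj : suppB vj ⊆ {j}) (hvjne : vj ≠ 0) :
    idealOf (T vi) ⊆ idealOf (T vj) := by
  have hzero : ∀ u : ∀ i, Fin (k i) → F, omegaW w u = 0 → u = 0 := fun u hu => by
    rw [omegaW_eq_sum_blockCost hw0, Finset.sum_eq_zero_iff] at hu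
    funext s
    by_contra h
    exact (blockCost_pos hw0 h).ne' (hu s (Finset.mem_univ s))
  have hinj : Function.Injective T := (injective_iff_map_eq_zero T).2 fun u hu => by
    have h0 : omegaW w (0 : ∀ i, Fin (k i) → F) = 0 := by
      simp [omegaW, maxOf, idealOf, suppB]
    exact hzero u (by rw [← hT, hu, h0])
  obtain ⟨t, hne, hmem⟩ :=
    exists_map_mem_supportedOn_pIdeal (T := LinearEquiv.ofInjectiveEndo T hinj) hk hw0 hT j
  have hsupp : ∀ {v : ∀ i, Fin (k i) → F} {r : ι}, suppB v ⊆ {r} → ∀ s, s ≠ r → v s = 0 :=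
    fun hv s hs => by
      by_contra h
      exact hs (Finset.mem_singleton.1 (hv (by simpa [suppB] using h)))
  have hvj' : vj = Pi.single j (vj j) := by
    funext s
    by_cases h : s = j
    · subst h
      simp
    · simp [h, hsupp hvj s h]
  have htj : T vj t ≠ 0 := by
    rw [hvj']
    exact hne _ fun h => hvjne (by rw [hvj', h, Pi.single_zero])
  have hTi : ∀ s, ¬ s ≤ t → T vi s = 0 := fun s hs => by
    refine hmem vi (fun r hr => hsupp hvi r ?_) s (by simpa [pIdeal] using hs)
    rintro rfl
    exact hr (by simpa [pIdeal] using hij)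
  intro s hs
  simp only [idealOf, suppB, Finset.mem_filter, Finset.mem_univ, true_and] at hs ⊢
  obtain ⟨r, hr, hsr⟩ := hs
  exact ⟨t, htj, hsr.trans (not_not.1 fun h => hr (hTi r h))⟩
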